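/- For every 0 < p < 1 and p < q ≤ 2 there exist constants c_{p,q}, C_{p,q} > 0 such that for all positive integers N, m with 1 ≤ m < N^2, c_{p,q} · min{1, N/m}^{1/p − 1/q} ≤ d^m(B_{S_{p,∞}}^N, S_q^N) ≤ C_{p,q} · min{1, N/m}^{1/p − 1/q}, where B_{S_{p,∞}}^N is the unit ball of the weak Schatten p-quasi-norm in M_N. -/

import Mathlib

noncomputable def singVals {N : ℕ} (X : Matrix (Fin N) (Fin N) ℝ) : Fin N → ℝ :=
  fun i => Real.sqrt ((Matrix.isHermitian_conjTranspose_mul_self X).eigenvalues i)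

/-- The Schatten `p`-quasi-norm of a real `N × N` matrix. -/
noncomputable def schattenNorm {N : ℕ} (p : ℝ) (X : Matrix (Fin N) (Fin N) ℝ) : ℝ :=
  (∑ i, singVals X i ^ p) ^ (1 / p)

/-- The singular values of `X` arranged in nonincreasing order:
`sortedSingVals X k` is the `(k+1)`-st largest singular value of `X`. -/
noncomputable def sortedSingVals {N : ℕ} (X : Matrix (Fin N) (Fin N) ℝ) : Fin N → ℝ :=
  fun k => (singVals X ∘ Tuple.sort (singVals X)) k.rev

/-- The weak Schatten `p`-quasi-norm: `max_{1 ≤ k ≤ N} k^{1/p} σ*_k(X)`. -/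
noncomputable def weakSchattenNorm {N : ℕ} (p : ℝ) (X : Matrix (Fin N) (Fin N) ℝ) : ℝ :=
  ⨆ k : Fin N, ((k : ℝ) + 1) ^ (1 / p) * sortedSingVals X k

/-- The Gelfand `m`-width of a subset `K` of the space of `N × N` real matrices, measured
in the Schatten `q`-quasi-norm. -/
noncomputable def gelfandWidth {N : ℕ} (m : ℕ) (K : Set (Matrix (Fin N) (Fin N) ℝ))
    (q : ℝ) : ℝ :=
  sInf { r : ℝ | ∃ L : Submodule ℝ (Matrix (Fin N) (Fin N) ℝ),
    Module.finrank ℝ (Matrix (Fin N) (Fin N) ℝ ⧸ L) ≤ m ∧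
    r = sSup (schattenNorm q '' (K ∩ (L : Set (Matrix (Fin N) (Fin N) ℝ)))) }

/-- The sign `±1` attached to a Boolean. -/
def boolSign (b : Bool) : ℝ := if b then 1 else -1

/-- The signed sum `∑ i, ± x i`, with signs prescribed by `f`. -/
def signedSum {n : ℕ} (f : Fin n → Bool) (x : Fin n → ℝ) : ℝ := ∑ i, boolSign (f i) * x i

theorem sum_signedSum_succ {n : ℕ} (g : ℝ → ℝ) (x : Fin (n + 1) → ℝ) :
    ∑ f : Fin (n + 1) → Bool, g (signedSum f x) =
      ∑ f : Fin n → Bool, (g (signedSum f (fun i => x i.succ) + x 0) +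
        g (signedSum f (fun i => x i.succ) - x 0)) := by
  rw [← (Fin.consEquiv fun _ : Fin (n + 1) => Bool).sum_comp, Fintype.sum_prod_type_right]
  refine Finset.sum_congr rfl fun f _ => ?_
  simp only [Fintype.sum_bool, signedSum, Fin.consEquiv, Equiv.coe_fn_mk, Fin.sum_univ_succ,
    Fin.cons_zero, Fin.cons_succ, boolSign]
  congr 2 <;> simp <;> ring

theorem sum_signedSum_sq {n : ℕ} (x : Fin n → ℝ) :
    ∑ f : Fin n → Bool, signedSum f x ^ 2 = 2 ^ n * ∑ i, x i ^ 2 := by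
  induction n with
  | zero => simp [signedSum]
  | succ n ih =>
    rw [sum_signedSum_succ (fun t => t ^ 2), Fin.sum_univ_succ]
    have h : ∀ s y : ℝ, (s + y) ^ 2 + (s - y) ^ 2 = 2 * s ^ 2 + 2 * y ^ 2 := fun s y => by ring
    simp only [h, Finset.sum_add_distrib, ← Finset.mul_sum, ih, Finset.sum_const,
      Finset.card_univ, Fintype.card_fun, Fintype.card_bool, Fintype.card_fin, nsmul_eq_mul]
    push_cast
    ring

theorem sum_signedSum_pow_four_le {n : ℕ} (x : Fin n → ℝ) :
    ∑ f : Fin n → Bool, signedSum f x ^ 4 ≤ 2 ^ n * (3 * (∑ i, x i ^ 2) ^ 2) := by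
  induction n with
  | zero => simp [signedSum]
  | succ n ih =>
    rw [sum_signedSum_succ (fun t => t ^ 4), Fin.sum_univ_succ]
    have h : ∀ s y : ℝ, (s + y) ^ 4 + (s - y) ^ 4 = 2 * s ^ 4 + 12 * y ^ 2 * s ^ 2 + 2 * y ^ 4 :=
      fun s y => by ring
    simp only [h, Finset.sum_add_distrib, ← Finset.mul_sum, sum_signedSum_sq, Finset.sum_const,
      Finset.card_univ, Fintype.card_fun, Fintype.card_bool, Fintype.card_fin, nsmul_eq_mul]
    have h2 := ih fun i => x i.succ
    have h3 : (0 : ℝ) ≤ 2 ^ n * (x 0 ^ 4) := by positivity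
    push_cast
    rw [pow_succ (2 : ℝ) n]
    nlinarith

theorem exp_neg_le_quadratic {t : ℝ} (ht : 0 ≤ t) : Real.exp (-t) ≤ 1 - t + t ^ 2 / 2 := by
  have h1 := Real.quadratic_le_exp_of_nonneg ht
  have h2 : 0 ≤ 1 - t + t ^ 2 / 2 := by nlinarith [sq_nonneg (t - 1)]
  rw [Real.exp_neg, inv_le_iff_one_le_mul₀ (Real.exp_pos t)]
  calc (1 : ℝ) ≤ (1 - t + t ^ 2 / 2) * (1 + t + t ^ 2 / 2) := by nlinarith [sq_nonneg (t ^ 2)]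
    _ ≤ _ := by gcongr

theorem sum_exp_neg_signedSum_sq_le {n : ℕ} (x : Fin n → ℝ) (hx : ∑ i, x i ^ 2 = 1) :
    ∑ f : Fin n → Bool, Real.exp (-(signedSum f x ^ 2 / 3)) ≤ 2 ^ n * (5 / 6) := by
  have h1 : ∀ f : Fin n → Bool, Real.exp (-(signedSum f x ^ 2 / 3)) ≤
      1 - signedSum f x ^ 2 / 3 + signedSum f x ^ 4 / 18 := fun f =>
    (exp_neg_le_quadratic (by positivity)).trans (le_of_eq (by ring))
  refine (Finset.sum_le_sum fun f _ => h1 f).trans ?_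
  have h4 := sum_signedSum_pow_four_le x
  rw [Finset.sum_add_distrib, Finset.sum_sub_distrib, ← Finset.sum_div, ← Finset.sum_div,
    sum_signedSum_sq, hx]
  rw [hx] at h4
  simp only [Finset.sum_const, Finset.card_univ, Fintype.card_fun, Fintype.card_bool,
    Fintype.card_fin, nsmul_eq_mul]
  push_cast
  linarith

/-- One step of the comparison of `exp (c Y²)` with its Gaussian counterpart. -/
theorem exp_sq_add_exp_sq_le {c : ℝ} (hc : 0 ≤ c) (s y : ℝ) (h : 2 * c * y ^ 2 < 1) :
    Real.exp (c * (s + y) ^ 2) + Real.exp (c * (s - y) ^ 2) ≤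
      2 * ((√(1 - 2 * c * y ^ 2))⁻¹ * Real.exp (c / (1 - 2 * c * y ^ 2) * s ^ 2)) := by
  set u := 2 * c * y ^ 2 with hu
  have hu0 : 0 ≤ u := by positivity
  have hpos : 0 < 1 - u := by linarith
  have h1 : Real.exp (c * (s + y) ^ 2) + Real.exp (c * (s - y) ^ 2) =
      2 * (Real.exp (c * s ^ 2 + c * y ^ 2) * Real.cosh (2 * c * s * y)) := by
    rw [Real.cosh_eq]
    have e1 : c * (s + y) ^ 2 = (c * s ^ 2 + c * y ^ 2) + 2 * c * s * y := by ring
    have e2 : c * (s - y) ^ 2 = (c * s ^ 2 + c * y ^ 2) + -(2 * c * s * y) := by ring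
    rw [e1, e2, Real.exp_add, Real.exp_add _ (-(2 * c * s * y))]
    ring
  have h2 : Real.exp (c * y ^ 2) ≤ (√(1 - u))⁻¹ := by
    rw [← Real.sqrt_inv]
    apply Real.le_sqrt_of_sq_le
    rw [← Real.exp_nat_mul, show ((2 : ℕ) : ℝ) * (c * y ^ 2) = u by rw [hu]; push_cast; ring]
    have := Real.add_one_le_exp (-u)
    rw [le_inv_comm₀ (Real.exp_pos u) hpos, ← Real.exp_neg]
    linarith
  have h3 : c * s ^ 2 * (1 + u) ≤ c / (1 - u) * s ^ 2 := by
    rw [div_mul_eq_mul_div, le_div_iff₀ hpos]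
    nlinarith [mul_nonneg (mul_nonneg hc (sq_nonneg s)) (sq_nonneg u)]
  rw [h1]
  gcongr 2 * ?_
  calc Real.exp (c * s ^ 2 + c * y ^ 2) * Real.cosh (2 * c * s * y)
      ≤ Real.exp (c * s ^ 2 + c * y ^ 2) * Real.exp ((2 * c * s * y) ^ 2 / 2) := by
        gcongr
        exact Real.cosh_le_exp_half_sq _
    _ = Real.exp (c * y ^ 2) * Real.exp (c * s ^ 2 * (1 + u)) := by
        rw [← Real.exp_add, ← Real.exp_add, hu]
        ring_nf
    _ ≤ _ := by gcongr

theorem sum_exp_signedSum_sq_le {n : ℕ} (x : Fin n → ℝ) {c : ℝ} (hc : 0 ≤ c)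
    (h : 2 * c * ∑ i, x i ^ 2 < 1) :
    ∑ f : Fin n → Bool, Real.exp (c * signedSum f x ^ 2) ≤
      2 ^ n * (√(1 - 2 * c * ∑ i, x i ^ 2))⁻¹ := by
  induction n generalizing c with
  | zero => simp [signedSum]
  | succ n ih =>
    rw [sum_signedSum_succ (fun t => Real.exp (c * t ^ 2))]
    rw [Fin.sum_univ_succ] at h ⊢
    set v := ∑ i : Fin n, x i.succ ^ 2 with hv
    have hv0 : 0 ≤ v := Finset.sum_nonneg fun i _ => sq_nonneg _
    have h0 : 2 * c * x 0 ^ 2 < 1 := by nlinarith [mul_nonneg hc hv0]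
    have hpos : 0 < 1 - 2 * c * x 0 ^ 2 := by linarith
    refine (Finset.sum_le_sum fun f _ => exp_sq_add_exp_sq_le hc _ _ h0).trans ?_
    rw [← Finset.mul_sum, ← Finset.mul_sum]
    have key := ih (fun i => x i.succ) (c := c / (1 - 2 * c * x 0 ^ 2)) (by positivity) (by
      rw [← hv, mul_div_assoc', div_mul_eq_mul_div, div_lt_one hpos]; linarith)
    rw [← hv] at key
    have e : 1 - 2 * c * (x 0 ^ 2 + v) =
        (1 - 2 * c * x 0 ^ 2) * (1 - 2 * (c / (1 - 2 * c * x 0 ^ 2)) * v) := by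
      field_simp
      ring
    rw [e, Real.sqrt_mul hpos.le, mul_inv, pow_succ (2 : ℝ) n]
    calc _ ≤ 2 * ((√(1 - 2 * c * x 0 ^ 2))⁻¹ *
          (2 ^ n * (√(1 - 2 * (c / (1 - 2 * c * x 0 ^ 2)) * v))⁻¹)) := by gcongr
      _ = _ := by ring

/-- The random sign matrix indexed by `F`, normalised by `1 / √m`, as a linear map. -/
noncomputable def signMap {m n : ℕ} (F : Fin m → Fin n → Bool) :
    EuclideanSpace ℝ (Fin n) →ₗ[ℝ] EuclideanSpace ℝ (Fin m) where
  toFun x := WithLp.toLp 2 fun l => (√m)⁻¹ * signedSum (F l) x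
  map_add' x y := by
    ext l
    simp [signedSum, mul_add, Finset.sum_add_distrib]
  map_smul' c x := by
    ext l
    simp only [signedSum, PiLp.smul_apply, smul_eq_mul, RingHom.id_apply, Finset.mul_sum]
    refine Finset.sum_congr rfl fun i _ => ?_
    ring

theorem norm_signMap_sq {m n : ℕ} (F : Fin m → Fin n → Bool) (x : EuclideanSpace ℝ (Fin n)) :
    ‖signMap F x‖ ^ 2 = (∑ l, signedSum (F l) x ^ 2) / m := by
  rw [EuclideanSpace.norm_sq_eq, Finset.sum_div]
  refine Finset.sum_congr rfl fun l _ => ?_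
  simp only [signMap, LinearMap.coe_mk, AddHom.coe_mk, Real.norm_eq_abs, sq_abs, mul_pow, inv_pow,
    Real.sq_sqrt (Nat.cast_nonneg m)]
  ring

theorem exp_one_twelfth_le : Real.exp (1 / 12) ≤ 12 / 11 := by
  have h := Real.add_one_le_exp (-(1 / 12 : ℝ))
  rw [Real.exp_neg] at h
  have h0 := Real.exp_pos (1 / 12)
  rw [le_inv_comm₀ (by norm_num) h0] at h
  exact h.trans (by norm_num)

theorem sqrt_two_mul_exp_neg_one_le : √2 * Real.exp (-1) ≤ 10 / 11 := by
  have h1 : √2 ≤ 3 / 2 := Real.sqrt_le_iff.2 ⟨by norm_num, by norm_num⟩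
  have h2 := Real.quadratic_le_exp_of_nonneg (zero_le_one (α := ℝ))
  have h3 : Real.exp (-1) ≤ 2 / 5 := by
    rw [Real.exp_neg]
    exact (inv_anti₀ (by norm_num) h2).trans (by norm_num)
  calc √2 * Real.exp (-1) ≤ 3 / 2 * (2 / 5) := by gcongr
    _ ≤ _ := by norm_num

/-- An exponential moment bound, over all sign matrices, that penalises those which strongly
shrink or stretch a given unit vector. -/
theorem sum_exp_signMap_le {m n : ℕ} (hm : 0 < m) (x : EuclideanSpace ℝ (Fin n)) (hx : ‖x‖ = 1) :
    ∑ F : Fin m → Fin n → Bool, (Real.exp (m / 12 - m * ‖signMap F x‖ ^ 2 / 3) +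
      Real.exp (m * ‖signMap F x‖ ^ 2 / 4 - m)) ≤
        2 * (10 / 11) ^ m * Fintype.card (Fin m → Fin n → Bool) := by
  have hx2 : ∑ i, x i ^ 2 = 1 := by
    have := EuclideanSpace.norm_sq_eq x
    rw [hx] at this
    simpa using this.symm
  have hm' : (m : ℝ) ≠ 0 := by positivity
  have hcard : (Fintype.card (Fin m → Fin n → Bool) : ℝ) = (2 ^ n) ^ m := by
    simp
  have hlow : ∑ F : Fin m → Fin n → Bool, Real.exp (m / 12 - m * ‖signMap F x‖ ^ 2 / 3) ≤
      (10 / 11) ^ m * (2 ^ n) ^ m := by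
    have e : ∀ F : Fin m → Fin n → Bool, Real.exp (m / 12 - m * ‖signMap F x‖ ^ 2 / 3) =
        ∏ l, (Real.exp (1 / 12) * Real.exp (-(signedSum (F l) x ^ 2 / 3))) := by
      intro F
      rw [norm_signMap_sq, mul_div_cancel₀ _ hm']
      simp_rw [← Real.exp_add]
      rw [← Real.exp_sum, Finset.sum_add_distrib]
      simp [Finset.sum_mul, sub_eq_add_neg, div_eq_mul_inv]
    simp_rw [e]
    rw [← Fintype.sum_pow fun f : Fin n → Bool =>
      Real.exp (1 / 12) * Real.exp (-(signedSum f x ^ 2 / 3)), ← Finset.mul_sum, ← mul_pow]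
    refine pow_le_pow_left₀ (by positivity) ?_ m
    calc _ ≤ (12 / 11 : ℝ) * (2 ^ n * (5 / 6)) :=
          mul_le_mul exp_one_twelfth_le (sum_exp_neg_signedSum_sq_le _ hx2)
            (by positivity) (by norm_num)
      _ = _ := by ring
  have hup : ∑ F : Fin m → Fin n → Bool, Real.exp (m * ‖signMap F x‖ ^ 2 / 4 - m) ≤
      (10 / 11) ^ m * (2 ^ n) ^ m := by
    have e : ∀ F : Fin m → Fin n → Bool, Real.exp (m * ‖signMap F x‖ ^ 2 / 4 - m) =
        ∏ l, (Real.exp (-1) * Real.exp (1 / 4 * signedSum (F l) x ^ 2)) := by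
      intro F
      rw [norm_signMap_sq, mul_div_cancel₀ _ hm']
      simp_rw [← Real.exp_add]
      rw [← Real.exp_sum, Finset.sum_add_distrib, ← Finset.mul_sum]
      congr 1
      simp
      ring
    simp_rw [e]
    rw [← Fintype.sum_pow fun f : Fin n → Bool =>
      Real.exp (-1) * Real.exp (1 / 4 * signedSum f x ^ 2), ← Finset.mul_sum, ← mul_pow]
    refine pow_le_pow_left₀ (by positivity) ?_ m
    have h := sum_exp_signedSum_sq_le (x : Fin n → ℝ) (c := 1 / 4) (by norm_num)
      (by rw [hx2]; norm_num)
    rw [hx2, show (1 : ℝ) - 2 * (1 / 4) * 1 = 2⁻¹ by norm_num, Real.sqrt_inv, inv_inv] at h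
    calc _ ≤ Real.exp (-1) * (2 ^ n * √2) := by gcongr
      _ = 2 ^ n * (√2 * Real.exp (-1)) := by ring
      _ ≤ 2 ^ n * (10 / 11) := by gcongr; exact sqrt_two_mul_exp_neg_one_le
      _ = _ := by ring
  rw [Finset.sum_add_distrib, hcard]
  linarith

/-- A Johnson–Lindenstrauss type lemma: some linear map into `ℝ^m` distorts none of the vectors of
an exponentially large finite set by more than a constant factor. -/
theorem exists_linearMap_almost_isometry {m n : ℕ} (hm : 0 < m)
    (Z : Finset (EuclideanSpace ℝ (Fin n))) (hZ : 2 * (Z.card : ℝ) * (10 / 11) ^ m < 1) :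
    ∃ A : EuclideanSpace ℝ (Fin n) →ₗ[ℝ] EuclideanSpace ℝ (Fin m),
      ∀ z ∈ Z, 1 / 2 * ‖z‖ ≤ ‖A z‖ ∧ ‖A z‖ ≤ 2 * ‖z‖ := by
  classical
  set Z' := (Z.erase 0).image fun z => ‖z‖⁻¹ • z with hZ'
  have hunit : ∀ z ∈ Z', ‖z‖ = 1 := by
    intro z hz
    obtain ⟨w, hw, rfl⟩ := Finset.mem_image.1 hz
    have : ‖w‖ ≠ 0 := norm_ne_zero_iff.2 (Finset.ne_of_mem_erase hw)
    rw [norm_smul, norm_inv, norm_norm, inv_mul_cancel₀ this]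
  have hcard : (Z'.card : ℝ) ≤ Z.card := by
    exact_mod_cast Finset.card_image_le.trans (Finset.card_le_card (Finset.erase_subset _ _))
  set W : (Fin m → Fin n → Bool) → ℝ := fun F => ∑ z ∈ Z',
    (Real.exp (m / 12 - m * ‖signMap F z‖ ^ 2 / 3) +
      Real.exp (m * ‖signMap F z‖ ^ 2 / 4 - m)) with hW
  obtain ⟨F, -, hF⟩ : ∃ F ∈ Finset.univ, W F < 1 := by
    apply Finset.exists_lt_of_sum_lt (g := fun _ => (1 : ℝ))
    rw [hW, Finset.sum_comm, Finset.sum_const, Finset.card_univ, nsmul_eq_mul, mul_one]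
    have hc : (0 : ℝ) < Fintype.card (Fin m → Fin n → Bool) := by
      exact_mod_cast Fintype.card_pos
    calc _ ≤ ∑ z ∈ Z', 2 * (10 / 11 : ℝ) ^ m * Fintype.card (Fin m → Fin n → Bool) :=
          Finset.sum_le_sum fun z hz => sum_exp_signMap_le hm z (hunit z hz)
      _ = (2 * (Z'.card : ℝ) * (10 / 11) ^ m) * Fintype.card (Fin m → Fin n → Bool) := by
          rw [Finset.sum_const, nsmul_eq_mul]; ring
      _ ≤ (2 * (Z.card : ℝ) * (10 / 11) ^ m) * Fintype.card (Fin m → Fin n → Bool) := by gcongr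
      _ < 1 * Fintype.card (Fin m → Fin n → Bool) := by gcongr
      _ = _ := one_mul _
  have hm' : (0 : ℝ) < m := by exact_mod_cast hm
  have key : ∀ z ∈ Z', 1 / 2 ≤ ‖signMap F z‖ ∧ ‖signMap F z‖ ≤ 2 := by
    intro z hz
    have h1 : Real.exp (m / 12 - m * ‖signMap F z‖ ^ 2 / 3) +
        Real.exp (m * ‖signMap F z‖ ^ 2 / 4 - m) < 1 :=
      (Finset.single_le_sum (f := fun z => Real.exp (m / 12 - m * ‖signMap F z‖ ^ 2 / 3) +
        Real.exp (m * ‖signMap F z‖ ^ 2 / 4 - m)) (fun _ _ => by positivity) hz).trans_lt hF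
    have h2 := Real.exp_lt_one_iff.1 ((le_add_of_nonneg_right (Real.exp_pos _).le).trans_lt h1)
    have h3 := Real.exp_lt_one_iff.1 ((le_add_of_nonneg_left (Real.exp_pos _).le).trans_lt h1)
    constructor
    · refine le_of_sq_le_sq ?_ (norm_nonneg _)
      by_contra! hlt
      nlinarith
    · refine le_of_sq_le_sq ?_ (by norm_num)
      by_contra! hlt
      nlinarith
  refine ⟨signMap F, fun z hz => ?_⟩
  rcases eq_or_ne z 0 with rfl | h0
  · simp
  have hn : 0 < ‖z‖ := norm_pos_iff.2 h0
  have hk := key (‖z‖⁻¹ • z)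
    (Finset.mem_image_of_mem _ (Finset.mem_erase.2 ⟨h0, hz⟩))
  rw [map_smul, norm_smul, norm_inv, norm_norm, ← div_eq_inv_mul, le_div_iff₀ hn,
    div_le_iff₀ hn] at hk
  exact hk

/-- A volume argument: an `ε`-net of the unit ball of cardinality at most `(1 + 2 / ε) ^ dim`. -/
theorem exists_finset_net_unitBall {E : Type*} [NormedAddCommGroup E] [NormedSpace ℝ E]
    [FiniteDimensional ℝ E] {ε : ℝ} (hε : 0 < ε) :
    ∃ S : Finset E, (∀ s ∈ S, ‖s‖ ≤ 1) ∧ (∀ x : E, ‖x‖ ≤ 1 → ∃ s ∈ S, ‖x - s‖ ≤ ε) ∧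
      (S.card : ℝ) ≤ (1 + 2 / ε) ^ Module.finrank ℝ E := by
  classical
  have hcard : ∀ S : Finset E, (∀ s ∈ S, ‖s‖ ≤ 1) →
      (∀ c ∈ S, ∀ d ∈ S, c ≠ d → ε ≤ ‖c - d‖) →
      (S.card : ℝ) ≤ (1 + 2 / ε) ^ Module.finrank ℝ E := by
    intro S hS h
    borelize E
    let μ : MeasureTheory.Measure E := MeasureTheory.Measure.addHaar
    have hδ : 0 < ε / 2 := by positivity
    have hρ : 0 < 1 + ε / 2 := by positivity
    have D : Set.Pairwise (S : Set E) (Function.onFun Disjoint fun c => Metric.ball c (ε / 2)) := by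
      intro c hc d hd hcd
      apply Metric.ball_disjoint_ball
      rw [dist_eq_norm, add_halves]
      exact h c hc d hd hcd
    have hsub : (⋃ c ∈ S, Metric.ball c (ε / 2)) ⊆ Metric.ball (0 : E) (1 + ε / 2) := by
      refine Set.iUnion₂_subset fun x hx => Metric.ball_subset_ball' ?_
      rw [dist_zero_right]
      linarith [hS x hx]
    have I : (S.card : ENNReal) * ENNReal.ofReal ((ε / 2) ^ Module.finrank ℝ E) *
        μ (Metric.ball 0 1) ≤
        ENNReal.ofReal ((1 + ε / 2) ^ Module.finrank ℝ E) * μ (Metric.ball 0 1) := by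
      rw [← μ.addHaar_ball_of_pos 0 hρ]
      refine le_trans (le_of_eq ?_) (MeasureTheory.measure_mono hsub)
      rw [MeasureTheory.measure_biUnion_finset D fun c _ => measurableSet_ball]
      simp only [μ.addHaar_ball_of_pos _ hδ, Finset.sum_const, nsmul_eq_mul, mul_assoc]
    have J := (ENNReal.mul_le_mul_iff_left
      (Metric.measure_ball_pos μ _ zero_lt_one).ne' MeasureTheory.measure_ball_lt_top.ne).1 I
    have K := ENNReal.toReal_le_of_le_ofReal (pow_nonneg hρ.le _) J
    rw [ENNReal.toReal_mul, ENNReal.toReal_natCast, ENNReal.toReal_ofReal (by positivity),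
      ← le_div_iff₀ (by positivity), ← div_pow] at K
    rwa [show (1 + ε / 2) / (ε / 2) = 1 + 2 / ε by field_simp; ring] at K
  obtain ⟨S, hS, hmax⟩ : ∃ S : Finset E, ((∀ s ∈ S, ‖s‖ ≤ 1) ∧
      (∀ c ∈ S, ∀ d ∈ S, c ≠ d → ε ≤ ‖c - d‖)) ∧ ∀ T : Finset E, ((∀ s ∈ T, ‖s‖ ≤ 1) ∧
      (∀ c ∈ T, ∀ d ∈ T, c ≠ d → ε ≤ ‖c - d‖)) → T.card ≤ S.card := by
    set P : ℕ → Prop := fun k => ∃ S : Finset E, ((∀ s ∈ S, ‖s‖ ≤ 1) ∧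
      (∀ c ∈ S, ∀ d ∈ S, c ≠ d → ε ≤ ‖c - d‖)) ∧ S.card = k with hP
    have hb : ∀ k, P k → k ≤ ⌊(1 + 2 / ε) ^ Module.finrank ℝ E⌋₊ := by
      rintro _ ⟨S, hS, rfl⟩
      exact Nat.le_floor (hcard S hS.1 hS.2)
    have h0 : P 0 := ⟨∅, by simp, rfl⟩
    obtain ⟨S, hS, hSc⟩ := Nat.findGreatest_spec (Nat.zero_le _) h0
    exact ⟨S, hS, fun T hT => hSc ▸ Nat.le_findGreatest (hb _ ⟨T, hT, rfl⟩) ⟨T, hT, rfl⟩⟩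
  refine ⟨S, hS.1, fun x hx => ?_, hcard S hS.1 hS.2⟩
  by_contra! hfar
  have hxS : x ∉ S := fun hxS => by
    have := hfar x hxS
    rw [sub_self, norm_zero] at this
    linarith
  have := hmax (insert x S) ⟨?_, ?_⟩
  · rw [Finset.card_insert_of_notMem hxS] at this
    omega
  · intro s hs
    rcases Finset.mem_insert.1 hs with rfl | hs
    exacts [hx, hS.1 s hs]
  · intro c hc d hd hcd
    rcases Finset.mem_insert.1 hc with rfl | hcS <;>
      rcases Finset.mem_insert.1 hd with rfl | hdS
    · exact absurd rfl hcd
    · exact (hfar d hdS).le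
    · rw [norm_sub_rev]
      exact (hfar c hcS).le
    · exact hS.2 c hcS d hdS hcd

theorem norm_sub_bilinear_le {E F G : Type*} [NormedAddCommGroup E] [NormedSpace ℝ E]
    [NormedAddCommGroup F] [NormedSpace ℝ F] [NormedAddCommGroup G] [NormedSpace ℝ G]
    (Ψ : E →L[ℝ] F →L[ℝ] G) {x s : E} {y t : F} {ε : ℝ} (hy : ‖y‖ ≤ 1) (hs : ‖s‖ ≤ 1)
    (hxs : ‖x - s‖ ≤ ε) (hyt : ‖y - t‖ ≤ ε) : ‖Ψ x y - Ψ s t‖ ≤ 2 * ε * ‖Ψ‖ := by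
  have hε : 0 ≤ ε := (norm_nonneg _).trans hxs
  have e : Ψ x y - Ψ s t = Ψ (x - s) y + Ψ s (y - t) := by simp
  rw [e]
  calc _ ≤ ‖Ψ (x - s) y‖ + ‖Ψ s (y - t)‖ := norm_add_le _ _
    _ ≤ ‖Ψ‖ * ‖x - s‖ * ‖y‖ + ‖Ψ‖ * ‖s‖ * ‖y - t‖ :=
        add_le_add (Ψ.le_opNorm₂ _ _) (Ψ.le_opNorm₂ _ _)
    _ ≤ ‖Ψ‖ * ε * 1 + ‖Ψ‖ * 1 * ε := by gcongr
    _ = _ := by ring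

/-- A linear map into `ℝ^m` that nearly preserves the norms of all vectors in the image of the
product of two unit balls under a bilinear map, as soon as `m` is a large multiple of the sum of
the dimensions of the two factors. -/
theorem exists_linearMap_bilinear_almost_isometry {E F H : Type*} [NormedAddCommGroup E]
    [NormedSpace ℝ E] [FiniteDimensional ℝ E] [NormedAddCommGroup F] [NormedSpace ℝ F]
    [FiniteDimensional ℝ F] [NormedAddCommGroup H] [InnerProductSpace ℝ H] [FiniteDimensional ℝ H]
    (Φ : E →L[ℝ] F →L[ℝ] H) (hΦ : ‖Φ‖ ≤ 1) {m : ℕ} (hm : 0 < m)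
    (h : 2 * (65 : ℝ) ^ (Module.finrank ℝ E + Module.finrank ℝ F) * (10 / 11) ^ m < 1) :
    ∃ A : H →ₗ[ℝ] EuclideanSpace ℝ (Fin m), ∀ x y, ‖x‖ ≤ 1 → ‖y‖ ≤ 1 →
      ‖A (Φ x y)‖ ≤ 4 ∧ 1 / 2 * ‖Φ x y‖ - 9 / 32 ≤ ‖A (Φ x y)‖ := by
  classical
  obtain ⟨S, hS1, hSnet, hScard⟩ :=
    exists_finset_net_unitBall (E := E) (ε := 1 / 32) (by norm_num)
  obtain ⟨T, hT1, hTnet, hTcard⟩ :=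
    exists_finset_net_unitBall (E := F) (ε := 1 / 32) (by norm_num)
  let e := (stdOrthonormalBasis ℝ H).repr
  set Z := (S ×ˢ T).image fun st => e (Φ st.1 st.2) with hZ
  have hZcard : (Z.card : ℝ) ≤ 65 ^ (Module.finrank ℝ E + Module.finrank ℝ F) := by
    norm_num at hScard hTcard
    calc (Z.card : ℝ) ≤ ((S ×ˢ T).card : ℝ) := by exact_mod_cast Finset.card_image_le
      _ = (S.card : ℝ) * T.card := by rw [Finset.card_product]; push_cast; rfl
      _ ≤ 65 ^ Module.finrank ℝ E * 65 ^ Module.finrank ℝ F := by gcongr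
      _ = _ := (pow_add _ _ _).symm
  obtain ⟨A', hA'⟩ := exists_linearMap_almost_isometry hm Z (lt_of_le_of_lt (by gcongr) h)
  let A : H →ₗ[ℝ] EuclideanSpace ℝ (Fin m) := A' ∘ₗ e.toLinearEquiv.toLinearMap
  have hA : ∀ s ∈ S, ∀ t ∈ T, 1 / 2 * ‖Φ s t‖ ≤ ‖A (Φ s t)‖ ∧ ‖A (Φ s t)‖ ≤ 2 * ‖Φ s t‖ := by
    intro s hs t ht
    have := hA' (e (Φ s t)) (Finset.mem_image.2 ⟨(s, t), Finset.mk_mem_product hs ht, rfl⟩)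
    rwa [e.norm_map] at this
  let Ψ : E →L[ℝ] F →L[ℝ] EuclideanSpace ℝ (Fin m) :=
    (ContinuousLinearMap.compL ℝ F H _ (LinearMap.toContinuousLinearMap A)).comp Φ
  have hΨ : ∀ x y, Ψ x y = A (Φ x y) := fun x y => rfl
  have hnet : ∀ s ∈ S, ∀ t ∈ T, ‖Ψ s t‖ ≤ 2 := by
    intro s hs t ht
    rw [hΨ]
    have h1 : ‖Φ s t‖ ≤ 1 := by
      calc ‖Φ s t‖ ≤ ‖Φ‖ * ‖s‖ * ‖t‖ := Φ.le_opNorm₂ _ _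
        _ ≤ 1 * 1 * 1 := by gcongr; exacts [hS1 s hs, hT1 t ht]
        _ = 1 := by norm_num
    linarith [(hA s hs t ht).2]
  have hbound : ∀ x y, ‖x‖ ≤ 1 → ‖y‖ ≤ 1 → ‖Ψ x y‖ ≤ 2 + ‖Ψ‖ / 16 := by
    intro x y hx hy
    obtain ⟨s, hs, hxs⟩ := hSnet x hx
    obtain ⟨t, ht, hyt⟩ := hTnet y hy
    have h1 := norm_sub_bilinear_le Ψ hy (hS1 s hs) hxs hyt
    linarith [norm_le_norm_add_norm_sub' (Ψ x y) (Ψ s t), hnet s hs t ht]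
  have hM : ‖Ψ‖ ≤ 4 := by
    have : ‖Ψ‖ ≤ 2 + ‖Ψ‖ / 16 :=
      ContinuousLinearMap.opNorm_le_of_unit_norm (by positivity) fun x hx =>
        ContinuousLinearMap.opNorm_le_of_unit_norm (by positivity) fun y hy =>
          hbound x y hx.le hy.le
    linarith
  refine ⟨A, fun x y hx hy => ⟨?_, ?_⟩⟩
  · rw [← hΨ]
    linarith [hbound x y hx hy]
  · rw [← hΨ]
    obtain ⟨s, hs, hxs⟩ := hSnet x hx
    obtain ⟨t, ht, hyt⟩ := hTnet y hy
    have h1 := norm_sub_bilinear_le Ψ hy (hS1 s hs) hxs hyt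
    have h2 := norm_sub_bilinear_le Φ hy (hS1 s hs) hxs hyt
    have h3 := norm_le_norm_add_norm_sub' (Φ x y) (Φ s t)
    have h4 := norm_le_norm_add_norm_sub (Ψ x y) (Ψ s t)
    have h5 := (hA s hs t ht).1
    rw [← hΨ] at h5
    linarith

/-- The bilinear map `(B, C) ↦ B Cᵀ`, where `B` carries the Frobenius norm and `C` the operator
norm. -/
noncomputable def mulTransposeBilin (N k : ℕ) :
    EuclideanSpace ℝ (Fin N × Fin k) →L[ℝ]
      (EuclideanSpace ℝ (Fin k) →L[ℝ] EuclideanSpace ℝ (Fin N)) →L[ℝ]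
        EuclideanSpace ℝ (Fin N × Fin N) :=
  LinearMap.mkContinuous₂
    (LinearMap.mk₂ ℝ
      (fun B C => WithLp.toLp 2 fun ij => C (WithLp.toLp 2 fun l => B (ij.1, l)) ij.2)
      (fun B B' C => by
        ext ij
        simp only [PiLp.add_apply]
        rw [← PiLp.add_apply, ← map_add]
        rfl)
      (fun c B C => by
        ext ij
        simp only [PiLp.smul_apply]
        rw [← PiLp.smul_apply, ← map_smul]
        rfl)
      (fun B C C' => by ext ij; simp)
      (fun c B C => by ext ij; simp))
    1 (fun B C => by
      rw [one_mul]
      refine le_of_sq_le_sq ?_ (by positivity)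
      rw [mul_pow, EuclideanSpace.norm_sq_eq, EuclideanSpace.norm_sq_eq, Fintype.sum_prod_type,
        Fintype.sum_prod_type, Finset.sum_mul]
      refine Finset.sum_le_sum fun i _ => ?_
      have h := C.le_opNorm (WithLp.toLp 2 fun l => B (i, l))
      have h2 := pow_le_pow_left₀ (norm_nonneg _) h 2
      rw [mul_pow, EuclideanSpace.norm_sq_eq, EuclideanSpace.norm_sq_eq, mul_comm] at h2
      exact h2)

theorem mulTransposeBilin_apply {N k : ℕ} (B : EuclideanSpace ℝ (Fin N × Fin k))
    (C : EuclideanSpace ℝ (Fin k) →L[ℝ] EuclideanSpace ℝ (Fin N)) (i j : Fin N) :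
    mulTransposeBilin N k B C (i, j) = C (WithLp.toLp 2 fun l => B (i, l)) j := rfl

set_option maxSynthPendingDepth 3 in
theorem norm_mulTransposeBilin_le (N k : ℕ) : ‖mulTransposeBilin N k‖ ≤ 1 :=
  LinearMap.mkContinuous₂_norm_le _ zero_le_one _

set_option maxSynthPendingDepth 3 in
/-- Measurements of matrices that are stable on the set of matrices of rank at most `k`. -/
theorem exists_linearMap_rank_almost_isometry {N k m : ℕ} (hN : 0 < N) (hk : 0 < k)
    (h : 200 * (N * k) ≤ m) :
    ∃ A : EuclideanSpace ℝ (Fin N × Fin N) →ₗ[ℝ] EuclideanSpace ℝ (Fin m),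
      ∀ B C, ‖C‖ ≤ 1 → ‖A (mulTransposeBilin N k B C)‖ ≤ 4 * ‖B‖ ∧
        1 / 2 * ‖mulTransposeBilin N k B C‖ - 9 / 32 * ‖B‖ ≤
          ‖A (mulTransposeBilin N k B C)‖ := by
  have hNk : 0 < N * k := Nat.mul_pos hN hk
  suffices hdim : 2 * (65 : ℝ) ^ (Module.finrank ℝ (EuclideanSpace ℝ (Fin N × Fin k)) +
      Module.finrank ℝ (EuclideanSpace ℝ (Fin k) →L[ℝ] EuclideanSpace ℝ (Fin N))) *
      (10 / 11) ^ m < 1 by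
    obtain ⟨A, hA⟩ := exists_linearMap_bilinear_almost_isometry _ (norm_mulTransposeBilin_le N k)
      (by omega) hdim
    refine ⟨A, fun B C hC => ?_⟩
    rcases eq_or_ne B 0 with rfl | hB
    · simp
    have hpos : 0 < ‖B‖ := norm_pos_iff.2 hB
    have h1 := hA (‖B‖⁻¹ • B) C
      (by rw [norm_smul, norm_inv, norm_norm, inv_mul_cancel₀ hpos.ne']) hC
    have e : ∀ t : ℝ, ‖B‖⁻¹ * t * ‖B‖ = t := fun t => by field_simp
    rw [map_smul, smul_apply, map_smul, norm_smul, norm_smul, norm_inv,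
      norm_norm] at h1
    have h2 := mul_le_mul_of_nonneg_right h1.1 hpos.le
    have h3 := mul_le_mul_of_nonneg_right h1.2 hpos.le
    rw [e] at h2 h3
    refine ⟨h2, le_trans (le_of_eq ?_) h3⟩
    field_simp
  have h1 : Module.finrank ℝ (EuclideanSpace ℝ (Fin N × Fin k)) = N * k := by simp
  have h2 : Module.finrank ℝ (EuclideanSpace ℝ (Fin k) →L[ℝ] EuclideanSpace ℝ (Fin N)) =
      N * k := by
    rw [← (LinearMap.toContinuousLinearMap (𝕜 := ℝ) (E := EuclideanSpace ℝ (Fin k))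
      (F' := EuclideanSpace ℝ (Fin N))).finrank_eq, Module.finrank_linearMap]
    simp [mul_comm]
  rw [h1, h2, ← two_mul, pow_mul]
  calc 2 * ((65 : ℝ) ^ 2) ^ (N * k) * (10 / 11) ^ m
      ≤ 2 ^ (N * k) * ((65 : ℝ) ^ 2) ^ (N * k) * (10 / 11) ^ (200 * (N * k)) := by
        gcongr ?_ * _ * ?_
        · exact le_self_pow₀ (by norm_num) hNk.ne'
        · exact pow_le_pow_of_le_one (by norm_num) (by norm_num) h
    _ = (2 * 65 ^ 2 * (10 / 11) ^ 200) ^ (N * k) := by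
        rw [mul_pow, mul_pow, ← pow_mul (10 / 11 : ℝ)]
    _ < 1 := pow_lt_one₀ (by positivity) (by norm_num) hNk.ne'

theorem sum_range_eq_sum_blocks {M : Type*} [AddCommMonoid M] {N k : ℕ} (hk : 0 < k) (f : ℕ → M)
    (hf : ∀ t, N ≤ t → f t = 0) :
    ∑ t ∈ Finset.range N, f t = ∑ i ∈ Finset.range N, ∑ l : Fin k, f (i * k + l) := by
  have h : ∀ a, ∑ t ∈ Finset.range (a * k), f t =
      ∑ i ∈ Finset.range a, ∑ l : Fin k, f (i * k + l) := by
    intro a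
    induction a with
    | zero => simp
    | succ a ih =>
      rw [add_mul, one_mul, Finset.sum_range_add, ih, Finset.sum_range_succ,
        Finset.sum_range fun x => f (a * k + x)]
  rw [← h]
  refine Finset.sum_subset (Finset.range_mono (Nat.le_mul_of_pos_right N hk)) fun t _ ht => ?_
  exact hf t (by simpa using ht)

section Blocks

variable {N : ℕ} (k : ℕ) (v w : ℕ → EuclideanSpace ℝ (Fin N)) (i : ℕ)

/-- The matrix with columns `w (i * k), …, w (i * k + k - 1)`. -/
noncomputable def blockFactor : EuclideanSpace ℝ (Fin N × Fin k) :=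
  WithLp.toLp 2 fun nl => w (i * k + nl.2) nl.1

/-- The operator with columns `v (i * k), …, v (i * k + k - 1)`. -/
noncomputable def blockOp : EuclideanSpace ℝ (Fin k) →L[ℝ] EuclideanSpace ℝ (Fin N) :=
  ∑ l : Fin k, (EuclideanSpace.proj l : EuclideanSpace ℝ (Fin k) →L[ℝ] ℝ).smulRight
    (v (i * k + l))

theorem blockOp_apply (x : EuclideanSpace ℝ (Fin k)) :
    blockOp k v i x = ∑ l : Fin k, x l • v (i * k + l) := by
  simp [blockOp]

theorem norm_blockFactor_sq : ‖blockFactor k w i‖ ^ 2 = ∑ l : Fin k, ‖w (i * k + l)‖ ^ 2 := by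
  simp_rw [EuclideanSpace.norm_sq_eq]
  rw [Fintype.sum_prod_type, Finset.sum_comm]
  rfl

variable {v}

theorem norm_blockOp_apply_sq
    (hv : ∀ s t, inner ℝ (v s) (v t) = if s = t ∧ s < N then (1 : ℝ) else 0)
    (x : EuclideanSpace ℝ (Fin k)) :
    ‖blockOp k v i x‖ ^ 2 = ∑ l : Fin k, if i * k + l < N then x l ^ 2 else 0 := by
  rw [blockOp_apply, ← real_inner_self_eq_norm_sq, sum_inner]
  refine Finset.sum_congr rfl fun l _ => ?_
  rw [inner_sum, Finset.sum_eq_single l]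
  · rw [real_inner_smul_left, real_inner_smul_right, hv]
    split_ifs with h1 h2 h2 <;> simp_all [sq]
  · intro l' _ hl
    rw [real_inner_smul_left, real_inner_smul_right, hv, if_neg]
    · simp
    · intro h
      exact hl (Fin.ext (by omega))
  · simp

theorem norm_blockOp_le
    (hv : ∀ s t, inner ℝ (v s) (v t) = if s = t ∧ s < N then (1 : ℝ) else 0) :
    ‖blockOp k v i‖ ≤ 1 := by
  refine ContinuousLinearMap.opNorm_le_bound _ zero_le_one fun x => ?_
  rw [one_mul]
  refine le_of_sq_le_sq ?_ (norm_nonneg _)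
  rw [norm_blockOp_apply_sq k i hv, EuclideanSpace.norm_sq_eq]
  refine Finset.sum_le_sum fun l _ => ?_
  rw [Real.norm_eq_abs, sq_abs]
  split_ifs
  · exact le_rfl
  · positivity

theorem norm_mulTransposeBilin_block_zero (hk : k ≤ N)
    (hv : ∀ s t, inner ℝ (v s) (v t) = if s = t ∧ s < N then (1 : ℝ) else 0) :
    ‖mulTransposeBilin N k (blockFactor k w 0) (blockOp k v 0)‖ = ‖blockFactor k w 0‖ := by
  rw [← sq_eq_sq₀ (norm_nonneg _) (norm_nonneg _), EuclideanSpace.norm_sq_eq,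
    EuclideanSpace.norm_sq_eq, Fintype.sum_prod_type, Fintype.sum_prod_type]
  refine Finset.sum_congr rfl fun n _ => ?_
  simp only [mulTransposeBilin_apply]
  rw [← EuclideanSpace.norm_sq_eq, norm_blockOp_apply_sq k 0 hv]
  refine Finset.sum_congr rfl fun l _ => ?_
  rw [if_pos (by have := l.2; omega), Real.norm_eq_abs, sq_abs]

theorem sum_mulTransposeBilin_blocks (hk : 0 < k) (hw : ∀ t, N ≤ t → w t = 0) :
    ∑ i ∈ Finset.range N, mulTransposeBilin N k (blockFactor k w i) (blockOp k v i) =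
      WithLp.toLp 2 fun ij => ∑ t ∈ Finset.range N, w t ij.1 * v t ij.2 := by
  ext ⟨n, j⟩
  simp only [WithLp.ofLp_sum, Finset.sum_apply, mulTransposeBilin_apply]
  rw [sum_range_eq_sum_blocks hk (fun t => w t n * v t j) fun t ht => by simp [hw t ht]]
  refine Finset.sum_congr rfl fun i _ => ?_
  rw [blockOp_apply]
  simp [blockFactor]

end Blocks

/-- The sum of the convergent series `∑ (i + 1) ^ (-s)`. -/
noncomputable def zetaSum (s : ℝ) : ℝ := ∑' i : ℕ, ((i : ℝ) + 1) ^ (-s)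

theorem summable_succ_rpow {s : ℝ} (hs : 1 < s) : Summable fun i : ℕ => ((i : ℝ) + 1) ^ (-s) := by
  have := (summable_nat_add_iff 1).2 (Real.summable_nat_rpow.2 (by linarith : -s < -1))
  simpa using this

theorem sum_range_le_zetaSum {s : ℝ} (hs : 1 < s) (n : ℕ) :
    ∑ i ∈ Finset.range n, ((i : ℝ) + 1) ^ (-s) ≤ zetaSum s :=
  (summable_succ_rpow hs).sum_le_tsum _ fun i _ => by positivity

theorem zetaSum_pos {s : ℝ} (hs : 1 < s) : 0 < zetaSum s := by
  have := sum_range_le_zetaSum hs 1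
  norm_num at this
  linarith

theorem rpow_block_le {k : ℕ} (hk : 0 < k) {s : ℝ} (hs : 0 < s) (i l : ℕ) :
    (((i + 1) * k + l : ℕ) + 1 : ℝ) ^ (-s) ≤ (k : ℝ) ^ (-s) * ((i : ℝ) + 1) ^ (-s) := by
  have hk' : (0 : ℝ) < k := by exact_mod_cast hk
  rw [← Real.mul_rpow (by positivity) (by positivity)]
  refine Real.rpow_le_rpow_of_nonpos (by positivity) ?_ (by linarith)
  push_cast
  nlinarith [(Nat.cast_nonneg l : (0 : ℝ) ≤ l)]

theorem norm_blockFactor_succ_le {N k : ℕ} (hk : 0 < k) {w : ℕ → EuclideanSpace ℝ (Fin N)} {s : ℝ}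
    (hs : 0 < s) (hσ : ∀ t : ℕ, ‖w t‖ ≤ ((t : ℝ) + 1) ^ (-s)) (i : ℕ) :
    ‖blockFactor k w (i + 1)‖ ≤ (k : ℝ) ^ (1 / 2 - s) * ((i : ℝ) + 1) ^ (-s) := by
  have hk' : (0 : ℝ) < k := by exact_mod_cast hk
  refine le_of_sq_le_sq ?_ (by positivity)
  rw [norm_blockFactor_sq]
  calc ∑ l : Fin k, ‖w ((i + 1) * k + l)‖ ^ 2
      ≤ ∑ _l : Fin k, ((k : ℝ) ^ (-s) * ((i : ℝ) + 1) ^ (-s)) ^ 2 := by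
        refine Finset.sum_le_sum fun l _ => ?_
        exact pow_le_pow_left₀ (norm_nonneg _) ((hσ _).trans (rpow_block_le hk hs i l)) 2
    _ = ((k : ℝ) ^ (1 / 2 : ℝ) * (k : ℝ) ^ (-s) * ((i : ℝ) + 1) ^ (-s)) ^ 2 := by
        rw [Finset.sum_const, Finset.card_univ, Fintype.card_fin, nsmul_eq_mul, mul_assoc,
          mul_pow ((k : ℝ) ^ (1 / 2 : ℝ)), ← Real.sqrt_eq_rpow, Real.sq_sqrt hk'.le]
    _ = _ := by rw [← Real.rpow_add hk', sub_eq_add_neg]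

/-- In the kernel of a stable measurement map, the leading `k` singular values are controlled by
the decay of the remaining ones. -/
theorem norm_blockFactor_zero_le {N k m : ℕ} (hk : 0 < k) (hkN : k ≤ N)
    {A : EuclideanSpace ℝ (Fin N × Fin N) →ₗ[ℝ] EuclideanSpace ℝ (Fin m)}
    (hA : ∀ B C, ‖C‖ ≤ 1 → ‖A (mulTransposeBilin N k B C)‖ ≤ 4 * ‖B‖ ∧
      1 / 2 * ‖mulTransposeBilin N k B C‖ - 9 / 32 * ‖B‖ ≤ ‖A (mulTransposeBilin N k B C)‖)
    {v w : ℕ → EuclideanSpace ℝ (Fin N)}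
    (hv : ∀ s t, inner ℝ (v s) (v t) = if s = t ∧ s < N then (1 : ℝ) else 0)
    (hw : ∀ t, N ≤ t → w t = 0) {s : ℝ} (hs : 1 < s)
    (hσ : ∀ t : ℕ, ‖w t‖ ≤ ((t : ℝ) + 1) ^ (-s))
    (hker : A (WithLp.toLp 2 fun ij => ∑ t ∈ Finset.range N, w t ij.1 * v t ij.2) = 0) :
    ‖blockFactor k w 0‖ ≤ 128 / 7 * zetaSum s * (k : ℝ) ^ (1 / 2 - s) := by
  obtain ⟨M, rfl⟩ : ∃ M, N = M + 1 := ⟨N - 1, by omega⟩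
  rw [← sum_mulTransposeBilin_blocks k w hk hw, Finset.sum_range_succ', map_add, map_sum] at hker
  have h0 := (hA (blockFactor k w 0) (blockOp k v 0) (norm_blockOp_le k 0 hv)).2
  rw [norm_mulTransposeBilin_block_zero k w hkN hv, eq_neg_of_add_eq_zero_right hker,
    norm_neg] at h0
  have h1 : ‖∑ i ∈ Finset.range M,
      A (mulTransposeBilin (M + 1) k (blockFactor k w (i + 1)) (blockOp k v (i + 1)))‖ ≤
      4 * (k : ℝ) ^ (1 / 2 - s) * zetaSum s :=
    calc _ ≤ ∑ i ∈ Finset.range M, 4 * ((k : ℝ) ^ (1 / 2 - s) * ((i : ℝ) + 1) ^ (-s)) := by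
          refine norm_sum_le_of_le _ fun i _ => ?_
          refine (hA _ _ (norm_blockOp_le k _ hv)).1.trans ?_
          gcongr
          exact norm_blockFactor_succ_le hk (by linarith) hσ i
      _ = 4 * (k : ℝ) ^ (1 / 2 - s) * ∑ i ∈ Finset.range M, ((i : ℝ) + 1) ^ (-s) := by
          rw [Finset.mul_sum]
          exact Finset.sum_congr rfl fun i _ => by ring
      _ ≤ _ := by gcongr; exact sum_range_le_zetaSum hs M
  linarith

theorem sum_rpow_le_of_sum_sq_le {k : ℕ} (hk : 0 < k) {x : Fin k → ℝ} (hx : ∀ l, 0 ≤ x l)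
    {q b : ℝ} (hq : 0 < q) (hq2 : q ≤ 2) (hb : 0 ≤ b) (h : ∑ l, x l ^ 2 ≤ b ^ 2) :
    ∑ l, x l ^ q ≤ (k : ℝ) ^ (1 - q / 2) * b ^ q := by
  have hk' : (0 : ℝ) < k := by exact_mod_cast hk
  have h1 := Real.rpow_sum_le_const_mul_sum_rpow_of_nonneg (Finset.univ : Finset (Fin k))
    (f := fun l => x l ^ q) (p := 2 / q) (by rwa [le_div_iff₀ hq, one_mul])
    (fun l _ => Real.rpow_nonneg (hx l) q)
  have h2 : ∀ l, (x l ^ q) ^ (2 / q) = x l ^ 2 := fun l => by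
    rw [← Real.rpow_mul (hx l), mul_div_cancel₀ _ hq.ne']
    exact_mod_cast Real.rpow_natCast (x l) 2
  simp only [h2, Finset.card_univ, Fintype.card_fin] at h1
  have h3 : (∑ l, x l ^ q) ^ (2 / q) ≤ (k : ℝ) ^ (2 / q - 1) * b ^ 2 := h1.trans (by gcongr)
  have hS : 0 ≤ ∑ l, x l ^ q := Finset.sum_nonneg fun l _ => Real.rpow_nonneg (hx l) q
  have h4 := Real.rpow_le_rpow (by positivity) h3 (by positivity : 0 ≤ q / 2)
  rw [← Real.rpow_mul hS, Real.mul_rpow (by positivity) (by positivity), ← Real.rpow_mul hk'.le,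
    ← Real.rpow_natCast b 2, ← Real.rpow_mul hb] at h4
  convert h4 using 2
  · rw [show 2 / q * (q / 2) = 1 by field_simp, Real.rpow_one]
  · congr 1
    field_simp
  · push_cast
    congr 1
    ring

/-- The `ℓ_q` bound for the singular values of a matrix in the kernel of a stable measurement
map. -/
theorem sum_rpow_le_of_blockFactor_zero_le {N k : ℕ} (hk : 0 < k) (hN : 0 < N)
    {w : ℕ → EuclideanSpace ℝ (Fin N)} (hw : ∀ t, N ≤ t → w t = 0) {s q b : ℝ} (hs : 0 < s)
    (hq : 0 < q) (hq2 : q ≤ 2) (hqs : 1 < q * s) (hb : 0 ≤ b)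
    (hσ : ∀ t : ℕ, ‖w t‖ ≤ ((t : ℝ) + 1) ^ (-s))
    (h0 : ‖blockFactor k w 0‖ ≤ b * (k : ℝ) ^ (1 / 2 - s)) :
    ∑ t ∈ Finset.range N, ‖w t‖ ^ q ≤ (k : ℝ) ^ (1 - q * s) * (b ^ q + zetaSum (q * s)) := by
  have hk' : (0 : ℝ) < k := by exact_mod_cast hk
  obtain ⟨M, rfl⟩ : ∃ M, N = M + 1 := ⟨N - 1, by omega⟩
  rw [sum_range_eq_sum_blocks hk (fun t => ‖w t‖ ^ q)
    (fun t ht => by simp [hw t ht, Real.zero_rpow hq.ne']), Finset.sum_range_succ', add_comm,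
    mul_add]
  gcongr ?_ + ?_
  · have h1 := sum_rpow_le_of_sum_sq_le hk (x := fun l : Fin k => ‖w (0 * k + l)‖)
      (fun l => norm_nonneg _) hq hq2 (b := b * (k : ℝ) ^ (1 / 2 - s)) (by positivity)
      (by rw [← norm_blockFactor_sq]; exact pow_le_pow_left₀ (norm_nonneg _) h0 2)
    refine h1.trans (le_of_eq ?_)
    rw [Real.mul_rpow hb (by positivity), ← Real.rpow_mul hk'.le, mul_left_comm,
      ← Real.rpow_add hk', mul_comm]
    congr 2
    ring
  · calc ∑ i ∈ Finset.range M, ∑ l : Fin k, ‖w ((i + 1) * k + l)‖ ^ q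
        ≤ ∑ i ∈ Finset.range M, ∑ _l : Fin k,
          ((k : ℝ) ^ (-(q * s)) * ((i : ℝ) + 1) ^ (-(q * s))) := by
          refine Finset.sum_le_sum fun i _ => Finset.sum_le_sum fun l _ => ?_
          refine (Real.rpow_le_rpow (norm_nonneg _) (hσ _) hq.le).trans ?_
          rw [← Real.rpow_mul (by positivity), show -s * q = -(q * s) by ring]
          exact rpow_block_le hk (by positivity) i l
      _ = (k : ℝ) ^ (1 - q * s) * ∑ i ∈ Finset.range M, ((i : ℝ) + 1) ^ (-(q * s)) := by
          rw [Finset.mul_sum]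
          refine Finset.sum_congr rfl fun i _ => ?_
          rw [Finset.sum_const, Finset.card_univ, Fintype.card_fin, nsmul_eq_mul, ← mul_assoc,
            sub_eq_add_neg, Real.rpow_add hk', Real.rpow_one]
      _ ≤ _ := by gcongr; exact sum_range_le_zetaSum hqs M

section SingularValues

open Matrix

variable {N : ℕ} (X : Matrix (Fin N) (Fin N) ℝ)

theorem singVals_nonneg (i : Fin N) : 0 ≤ singVals X i := Real.sqrt_nonneg _

theorem singVals_sq (i : Fin N) :
    singVals X i ^ 2 = (isHermitian_conjTranspose_mul_self X).eigenvalues i :=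
  Real.sq_sqrt ((posSemidef_conjTranspose_mul_self X).eigenvalues_nonneg i)

theorem schattenNorm_nonneg (q : ℝ) : 0 ≤ schattenNorm q X :=
  Real.rpow_nonneg (Finset.sum_nonneg fun i _ => Real.rpow_nonneg (singVals_nonneg X i) q) _

/-- The permutation arranging the singular values in nonincreasing order. -/
noncomputable def singValsPerm : Equiv.Perm (Fin N) := Fin.revPerm.trans (Tuple.sort (singVals X))

theorem sortedSingVals_eq (k : Fin N) : sortedSingVals X k = singVals X (singValsPerm X k) := rfl

theorem sortedSingVals_nonneg (k : Fin N) : 0 ≤ sortedSingVals X k := singVals_nonneg X _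

theorem antitone_sortedSingVals : Antitone (sortedSingVals X) := fun _ _ h =>
  Tuple.monotone_sort (singVals X) (Fin.rev_le_rev.2 h)

theorem sum_sortedSingVals (g : ℝ → ℝ) :
    ∑ k, g (sortedSingVals X k) = ∑ i, g (singVals X i) :=
  Equiv.sum_comp (singValsPerm X) fun i => g (singVals X i)

theorem norm_mulVec_eigenvectorBasis (i : Fin N) :
    ‖(WithLp.toLp 2 (X *ᵥ ((isHermitian_conjTranspose_mul_self X).eigenvectorBasis i)) :
      EuclideanSpace ℝ (Fin N))‖ = singVals X i := by
  set hA := isHermitian_conjTranspose_mul_self X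
  refine (sq_eq_sq₀ (norm_nonneg _) (singVals_nonneg X i)).1 ?_
  rw [singVals_sq, hA.eigenvalues_eq, EuclideanSpace.norm_sq_eq, ← mulVec_mulVec,
    dotProduct_mulVec]
  simp [dotProduct, vecMul_transpose, sq]

/-- A singular value decomposition, indexed by `ℕ` and with the singular values in nonincreasing
order. -/
theorem exists_singular_decomposition :
    ∃ v w : ℕ → EuclideanSpace ℝ (Fin N),
      (∀ s t, inner ℝ (v s) (v t) = if s = t ∧ s < N then (1 : ℝ) else 0) ∧
      (∀ t : Fin N, ‖w t‖ = sortedSingVals X t) ∧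
      (∀ t, N ≤ t → w t = 0) ∧
      ∀ i j, X i j = ∑ t ∈ Finset.range N, w t i * v t j := by
  set b := (isHermitian_conjTranspose_mul_self X).eigenvectorBasis with hb
  set b' := b.reindex (singValsPerm X).symm with hb'
  refine ⟨fun t => if h : t < N then b' ⟨t, h⟩ else 0,
    fun t => if h : t < N then WithLp.toLp 2 (X *ᵥ (b' ⟨t, h⟩)) else 0, ?_, ?_, ?_, ?_⟩
  · intro s t
    by_cases hs : s < N <;> by_cases ht : t < N
    · simp only [hs, ht, dite_true, and_true]
      rw [orthonormal_iff_ite.1 b'.orthonormal]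
      simp
    · have : s ≠ t := by omega
      simp [hs, ht, this]
    · simp [hs]
    · simp [hs]
  · intro t
    simp only [t.2, dite_true, Fin.eta]
    rw [sortedSingVals_eq, ← norm_mulVec_eigenvectorBasis, hb']
    simp [hb]
  · intro t ht
    simp [not_lt.2 ht]
  · intro i j
    rw [Finset.sum_range]
    simp only [Fin.is_lt, dite_true, Fin.eta]
    have h := congrArg (fun x : EuclideanSpace ℝ (Fin N) => x j)
      (b'.sum_repr' (WithLp.toLp 2 (X i)))
    simp only [WithLp.ofLp_sum, Finset.sum_apply, WithLp.ofLp_smul, Pi.smul_apply,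
      smul_eq_mul] at h
    rw [← h]
    refine Finset.sum_congr rfl fun t _ => ?_
    simp [PiLp.inner_apply, mulVec, dotProduct]

theorem sortedSingVals_le_of_weakSchattenNorm_le_one {p : ℝ} (h : weakSchattenNorm p X ≤ 1)
    (k : Fin N) : sortedSingVals X k ≤ ((k : ℝ) + 1) ^ (-(1 / p)) := by
  have hk : ((k : ℝ) + 1) ^ (1 / p) * sortedSingVals X k ≤ 1 :=
    (le_ciSup (f := fun k : Fin N => ((k : ℝ) + 1) ^ (1 / p) * sortedSingVals X k)
      (Set.finite_range _).bddAbove k).trans h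
  have hpos : 0 < ((k : ℝ) + 1) ^ (1 / p) := by positivity
  rw [Real.rpow_neg (by positivity), ← one_div, le_div_iff₀ hpos]
  linarith

theorem sum_rpow_singVals_le_zetaSum {p q : ℝ} (hq : 0 < q) (hpq : 1 < q * (1 / p))
    (h : weakSchattenNorm p X ≤ 1) : ∑ i, singVals X i ^ q ≤ zetaSum (q * (1 / p)) := by
  rw [← sum_sortedSingVals X (· ^ q)]
  refine le_trans ?_ (sum_range_le_zetaSum hpq N)
  rw [Finset.sum_range]
  refine Finset.sum_le_sum fun k _ => ?_
  refine (Real.rpow_le_rpow (sortedSingVals_nonneg X k)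
    (sortedSingVals_le_of_weakSchattenNorm_le_one X h k) hq.le).trans_eq ?_
  rw [← Real.rpow_mul (by positivity)]
  congr 1
  ring

theorem schattenNorm_le_zetaSum {p q : ℝ} (hq : 0 < q) (hpq : 1 < q * (1 / p))
    (h : weakSchattenNorm p X ≤ 1) : schattenNorm q X ≤ zetaSum (q * (1 / p)) ^ (1 / q) :=
  Real.rpow_le_rpow (Finset.sum_nonneg fun i _ => Real.rpow_nonneg (singVals_nonneg X i) q)
    (sum_rpow_singVals_le_zetaSum X hq hpq h) (by positivity)

theorem sum_eigenvalues_of_eq_smul {A B : Matrix (Fin N) (Fin N) ℝ} (hA : A.IsHermitian)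
    (hB : B.IsHermitian) {c : ℝ} (h : B = c • A) (g : ℝ → ℝ) :
    ∑ i, g (hB.eigenvalues i) = ∑ i, g (c * hA.eigenvalues i) := by
  have hchar : B.charpoly = ∏ i, (Polynomial.X - Polynomial.C (c * hA.eigenvalues i)) := by
    have hdiag : c • (diagonal (RCLike.ofReal ∘ hA.eigenvalues) : Matrix (Fin N) (Fin N) ℝ) =
        diagonal fun i => c * hA.eigenvalues i := by
      rw [← diagonal_smul]; rfl
    rw [h]
    conv_lhs => rw [hA.spectral_theorem, ← map_smul, hdiag, Unitary.conjStarAlgAut_apply,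
      charpoly_mul_comm, ← mul_assoc]
    simp [charpoly_diagonal]
  have hroots := hB.roots_charpoly_eq_eigenvalues
  rw [hchar, Polynomial.roots_prod _ _ (Finset.prod_ne_zero_iff.2 fun i _ =>
    Polynomial.X_sub_C_ne_zero _)] at hroots
  simp only [Polynomial.roots_X_sub_C, Multiset.bind_singleton] at hroots
  have := congrArg (fun s => (s.map g).sum) hroots
  simp only [Multiset.map_map] at this
  exact this.symm

theorem schattenNorm_smul {q : ℝ} (hq : 0 < q) {t : ℝ} (ht : 0 ≤ t) :
    schattenNorm q (t • X) = t * schattenNorm q X := by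
  have h : (t • X)ᴴ * (t • X) = (t ^ 2) • (Xᴴ * X) := by
    simp [smul_smul, sq]
  have hsum : ∑ i, singVals (t • X) i ^ q = t ^ q * ∑ i, singVals X i ^ q := by
    rw [Finset.mul_sum]
    refine (sum_eigenvalues_of_eq_smul (isHermitian_conjTranspose_mul_self X)
      (isHermitian_conjTranspose_mul_self (t • X)) h fun x => Real.sqrt x ^ q).trans ?_
    refine Finset.sum_congr rfl fun i _ => ?_
    rw [Real.sqrt_mul (sq_nonneg t), Real.sqrt_sq ht,
      Real.mul_rpow ht (Real.sqrt_nonneg _), singVals]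
  rw [schattenNorm, hsum, Real.mul_rpow (by positivity)
    (Finset.sum_nonneg fun i _ => Real.rpow_nonneg (singVals_nonneg X i) q),
    ← Real.rpow_mul ht, mul_one_div_cancel hq.ne', Real.rpow_one, schattenNorm]

theorem schattenNorm_pos {q : ℝ} (hX : X ≠ 0) : 0 < schattenNorm q X := by
  have hne : (isHermitian_conjTranspose_mul_self X).eigenvalues ≠ 0 := fun h =>
    hX (conjTranspose_mul_self_eq_zero.1
      ((isHermitian_conjTranspose_mul_self X).eigenvalues_eq_zero_iff.1 h))
  obtain ⟨i, hi⟩ := Function.ne_iff.1 hne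
  have hpos : 0 < singVals X i := Real.sqrt_pos.2
    (lt_of_le_of_ne ((posSemidef_conjTranspose_mul_self X).eigenvalues_nonneg i) (Ne.symm hi))
  exact Real.rpow_pos_of_pos (Finset.sum_pos'
    (fun j _ => Real.rpow_nonneg (singVals_nonneg X j) q)
    ⟨i, Finset.mem_univ i, Real.rpow_pos_of_pos hpos q⟩) _

theorem sortedSingVals_eq_zero_of_rank_le {k : Fin N} (hk : X.rank ≤ k) :
    sortedSingVals X k = 0 := by
  by_contra hne
  have hpos := lt_of_le_of_ne (sortedSingVals_nonneg X k) (Ne.symm hne)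
  have hcard : X.rank = Fintype.card
      {i // (isHermitian_conjTranspose_mul_self X).eigenvalues i ≠ 0} := by
    rw [← rank_conjTranspose_mul_self,
      (isHermitian_conjTranspose_mul_self X).rank_eq_card_non_zero_eigs]
  have hinj : Fintype.card (Finset.Iic k) ≤ Fintype.card
      {i // (isHermitian_conjTranspose_mul_self X).eigenvalues i ≠ 0} := by
    refine Fintype.card_le_of_injective
      (fun j => ⟨singValsPerm X j, fun h => ?_⟩) fun a b hab => ?_
    · have := antitone_sortedSingVals X (Finset.mem_Iic.1 j.2)
      rw [sortedSingVals_eq X j, singVals, h, Real.sqrt_zero] at this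
      exact absurd this (not_le.2 hpos)
    · exact Subtype.ext ((singValsPerm X).injective (congrArg Subtype.val hab))
  rw [← hcard, Fintype.card_coe, Fin.card_Iic] at hinj
  omega

theorem succ_mul_sortedSingVals_rpow_le {q : ℝ} (hq : 0 < q) (k : Fin N) :
    ((k : ℝ) + 1) * sortedSingVals X k ^ q ≤ ∑ i, singVals X i ^ q := by
  rw [← sum_sortedSingVals X (· ^ q)]
  calc ((k : ℝ) + 1) * sortedSingVals X k ^ q
      = ∑ _j ∈ Finset.Iic k, sortedSingVals X k ^ q := by
        rw [Finset.sum_const, Fin.card_Iic]; simp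
    _ ≤ ∑ j ∈ Finset.Iic k, sortedSingVals X j ^ q := Finset.sum_le_sum fun j hj =>
        Real.rpow_le_rpow (sortedSingVals_nonneg X k)
          (antitone_sortedSingVals X (Finset.mem_Iic.1 hj)) hq.le
    _ ≤ ∑ j, sortedSingVals X j ^ q := Finset.sum_le_sum_of_subset_of_nonneg
        (Finset.subset_univ _) fun j _ _ => Real.rpow_nonneg (sortedSingVals_nonneg X j) q

theorem weakSchattenNorm_le_of_rank_le {p q : ℝ} (hp : 0 < p) (hpq : p < q) {r : ℕ}
    (hr : X.rank ≤ r) :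
    weakSchattenNorm p X ≤ (r : ℝ) ^ (1 / p - 1 / q) * schattenNorm q X := by
  have hq : 0 < q := hp.trans hpq
  have hexp : 0 ≤ 1 / p - 1 / q := sub_nonneg.2 (one_div_le_one_div_of_le hp hpq.le)
  have hnn : 0 ≤ (r : ℝ) ^ (1 / p - 1 / q) * schattenNorm q X :=
    mul_nonneg (by positivity) (schattenNorm_nonneg X q)
  refine Real.iSup_le (fun k => ?_) hnn
  by_cases hk : X.rank ≤ k
  · rw [sortedSingVals_eq_zero_of_rank_le X hk, mul_zero]
    exact hnn
  have hkr : ((k : ℝ) + 1) ≤ r := by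
    have : (k : ℕ) + 1 ≤ r := by omega
    exact_mod_cast this
  have h1 : ((k : ℝ) + 1) ^ (1 / q) * sortedSingVals X k ≤ schattenNorm q X := by
    have h := Real.rpow_le_rpow
      (mul_nonneg (by positivity) (Real.rpow_nonneg (sortedSingVals_nonneg X k) q))
      (succ_mul_sortedSingVals_rpow_le X hq k) (one_div_pos.2 hq).le
    rwa [Real.mul_rpow (by positivity) (Real.rpow_nonneg (sortedSingVals_nonneg X k) q),
      ← Real.rpow_mul (sortedSingVals_nonneg X k), mul_one_div_cancel hq.ne',
      Real.rpow_one] at h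
  calc ((k : ℝ) + 1) ^ (1 / p) * sortedSingVals X k
      = ((k : ℝ) + 1) ^ (1 / p - 1 / q) * (((k : ℝ) + 1) ^ (1 / q) * sortedSingVals X k) := by
        rw [← mul_assoc, ← Real.rpow_add (by positivity), sub_add_cancel]
    _ ≤ _ := mul_le_mul (Real.rpow_le_rpow (by positivity) hkr hexp) h1
        (mul_nonneg (by positivity) (sortedSingVals_nonneg X k)) (by positivity)

end SingularValues

section GelfandWidth

variable {N : ℕ}

theorem exists_mem_ne_zero_rank_le {m r : ℕ} (hrN : r ≤ N) (hm : m < r * N)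
    (L : Submodule ℝ (Matrix (Fin N) (Fin N) ℝ))
    (hL : Module.finrank ℝ (Matrix (Fin N) (Fin N) ℝ ⧸ L) ≤ m) :
    ∃ X ∈ L, X ≠ 0 ∧ X.rank ≤ r := by
  let P : Matrix (Fin N) (Fin r) ℝ := fun i j => if j.castLE hrN = i then 1 else 0
  have hP : ∀ (Y : Matrix (Fin r) (Fin N) ℝ) i j, (P * Y) (i.castLE hrN) j = Y i j := by
    intro Y i j
    rw [Matrix.mul_apply]
    simp [P]
  let f : Matrix (Fin r) (Fin N) ℝ →ₗ[ℝ] Matrix (Fin N) (Fin N) ℝ ⧸ L :=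
    L.mkQ ∘ₗ mulLeftLinearMap (Fin N) ℝ P
  have hf : LinearMap.ker f ≠ ⊥ := by
    refine LinearMap.ker_ne_bot_of_finrank_lt (hL.trans_lt ?_)
    simpa [Module.finrank_matrix] using hm
  obtain ⟨Y, hY, hY0⟩ := (Submodule.ne_bot_iff _).1 hf
  refine ⟨P * Y, (Submodule.Quotient.mk_eq_zero L).1 hY, fun h => hY0 ?_, ?_⟩
  · ext i j
    rw [← hP Y i j, h, Matrix.zero_apply, Matrix.zero_apply]
  · exact (Matrix.rank_mul_le_left P Y).trans ((Matrix.rank_le_card_width P).trans_eq (by simp))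

/-- The part of the unit ball of the weak Schatten norm lying in a subspace has bounded image under
the Schatten norm. -/
theorem bddAbove_schattenNorm_image {p q : ℝ} (hp : 0 < p) (hpq : p < q)
    (S : Set (Matrix (Fin N) (Fin N) ℝ)) :
    BddAbove (schattenNorm q '' ({X | weakSchattenNorm p X ≤ 1} ∩ S)) := by
  refine ⟨zetaSum (q * (1 / p)) ^ (1 / q), ?_⟩
  rintro _ ⟨X, ⟨hX, -⟩, rfl⟩
  exact schattenNorm_le_zetaSum X (hp.trans hpq) (by rwa [mul_one_div, one_lt_div hp]) hX

theorem le_gelfandWidth {p q : ℝ} (hp : 0 < p) (hpq : p < q) {m r : ℕ} (hrN : r ≤ N)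
    (hm : m < r * N) :
    (r : ℝ) ^ (-(1 / p - 1 / q)) ≤
      gelfandWidth m {X : Matrix (Fin N) (Fin N) ℝ | weakSchattenNorm p X ≤ 1} q := by
  have hq : 0 < q := hp.trans hpq
  have hr : (0 : ℝ) < r := by
    have : 0 < r := Nat.pos_of_ne_zero fun h => by simp [h] at hm
    exact_mod_cast this
  refine le_csInf
    ⟨_, ⊤, by rw [Module.finrank_zero_of_subsingleton]; exact Nat.zero_le m, rfl⟩ ?_
  rintro _ ⟨L, hL, rfl⟩
  obtain ⟨X, hXL, hX0, hXr⟩ := exists_mem_ne_zero_rank_le hrN hm L hL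
  have hXpos := schattenNorm_pos X (q := q) hX0
  set t := (r : ℝ) ^ (-(1 / p - 1 / q)) / schattenNorm q X with ht
  have hnorm : schattenNorm q (t • X) = (r : ℝ) ^ (-(1 / p - 1 / q)) := by
    rw [schattenNorm_smul X hq (by positivity), ht, div_mul_cancel₀ _ hXpos.ne']
  have hrank : (t • X).rank ≤ r := by
    rw [Matrix.smul_eq_diagonal_mul]
    exact (Matrix.rank_mul_le_right _ _).trans hXr
  refine hnorm.ge.trans (le_csSup (bddAbove_schattenNorm_image hp hpq _)
    ⟨t • X, ⟨?_, L.smul_mem t hXL⟩, rfl⟩)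
  refine (weakSchattenNorm_le_of_rank_le _ hp hpq hrank).trans_eq ?_
  rw [hnorm, ← Real.rpow_add hr, add_neg_cancel, Real.rpow_zero]

theorem gelfandWidth_le {K : Set (Matrix (Fin N) (Fin N) ℝ)} {m : ℕ} {q a : ℝ} (ha : 0 ≤ a)
    (L : Submodule ℝ (Matrix (Fin N) (Fin N) ℝ))
    (hL : Module.finrank ℝ (Matrix (Fin N) (Fin N) ℝ ⧸ L) ≤ m)
    (h : ∀ X ∈ K, X ∈ L → schattenNorm q X ≤ a) : gelfandWidth m K q ≤ a := by
  refine csInf_le_of_le ⟨0, ?_⟩ ⟨L, hL, rfl⟩ (Real.sSup_le ?_ ha)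
  · rintro _ ⟨L', -, rfl⟩
    refine Real.sSup_nonneg ?_
    rintro _ ⟨X, -, rfl⟩
    exact schattenNorm_nonneg X q
  · rintro _ ⟨X, ⟨hXK, hXL⟩, rfl⟩
    exact h X hXK hXL

theorem gelfandWidth_le_zetaSum {p q : ℝ} (hp : 0 < p) (hpq : p < q) (m : ℕ) :
    gelfandWidth m {X : Matrix (Fin N) (Fin N) ℝ | weakSchattenNorm p X ≤ 1} q ≤
      zetaSum (q * (1 / p)) ^ (1 / q) := by
  have hs : 1 < q * (1 / p) := by rwa [mul_one_div, one_lt_div hp]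
  refine gelfandWidth_le (Real.rpow_nonneg (zetaSum_pos hs).le _) ⊤
    (by rw [Module.finrank_zero_of_subsingleton]; exact Nat.zero_le m) fun X hX _ => ?_
  exact schattenNorm_le_zetaSum X (hp.trans hpq) hs hX

theorem gelfandWidth_le_mul_rpow {p q : ℝ} (hp : 0 < p) (hp1 : p < 1) (hpq : p < q) (hq2 : q ≤ 2)
    {k m : ℕ} (hk : 0 < k) (hkN : k ≤ N) (hm : 200 * (N * k) ≤ m) :
    gelfandWidth m {X : Matrix (Fin N) (Fin N) ℝ | weakSchattenNorm p X ≤ 1} q ≤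
      ((128 / 7 * zetaSum (1 / p)) ^ q + zetaSum (q * (1 / p))) ^ (1 / q) *
        (k : ℝ) ^ (-(1 / p - 1 / q)) := by
  have hN : 0 < N := hk.trans_le hkN
  have hq : 0 < q := hp.trans hpq
  have hs : 1 < 1 / p := by rwa [lt_div_iff₀ hp, one_mul]
  have hqs : 1 < q * (1 / p) := by rwa [mul_one_div, one_lt_div hp]
  have hb : 0 ≤ 128 / 7 * zetaSum (1 / p) := mul_nonneg (by norm_num) (zetaSum_pos hs).le
  have hD : 0 ≤ (128 / 7 * zetaSum (1 / p)) ^ q + zetaSum (q * (1 / p)) :=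
    add_nonneg (Real.rpow_nonneg hb q) (zetaSum_pos hqs).le
  obtain ⟨A, hA⟩ := exists_linearMap_rank_almost_isometry hN hk hm
  let f : Matrix (Fin N) (Fin N) ℝ →ₗ[ℝ] EuclideanSpace ℝ (Fin m) :=
    A ∘ₗ
    { toFun := fun X => WithLp.toLp 2 fun ij : Fin N × Fin N => X ij.1 ij.2
      map_add' := fun _ _ => rfl
      map_smul' := fun _ _ => rfl }
  refine gelfandWidth_le (by positivity) (LinearMap.ker f) ?_ fun X hX hXL => ?_
  · rw [f.quotKerEquivRange.finrank_eq]
    exact (Submodule.finrank_le _).trans_eq finrank_euclideanSpace_fin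
  obtain ⟨v, w, hv, hnorm, hw, hXvw⟩ := exists_singular_decomposition X
  have hσ : ∀ t : ℕ, ‖w t‖ ≤ ((t : ℝ) + 1) ^ (-(1 / p)) := fun t => by
    by_cases ht : t < N
    · exact (hnorm ⟨t, ht⟩).trans_le (sortedSingVals_le_of_weakSchattenNorm_le_one X hX ⟨t, ht⟩)
    · rw [hw t (not_lt.1 ht), norm_zero]
      positivity
  have hker : A (WithLp.toLp 2 fun ij => ∑ t ∈ Finset.range N, w t ij.1 * v t ij.2) = 0 := by
    simp only [← hXvw]
    exact hXL
  have hsum := sum_rpow_le_of_blockFactor_zero_le hk hN hw (zero_lt_one.trans hs) hq hq2 hqs hb hσ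
    (norm_blockFactor_zero_le hk hkN hA hv hw hs hσ hker)
  have hsing : ∑ t ∈ Finset.range N, ‖w t‖ ^ q = ∑ i, singVals X i ^ q := by
    rw [Finset.sum_range, ← sum_sortedSingVals X (· ^ q)]
    simp only [hnorm]
  rw [hsing] at hsum
  refine (Real.rpow_le_rpow (Finset.sum_nonneg fun i _ =>
    Real.rpow_nonneg (singVals_nonneg X i) q) hsum (one_div_pos.2 hq).le).trans_eq ?_
  rw [Real.mul_rpow (by positivity) hD, ← Real.rpow_mul (by positivity), mul_comm]
  congr 2
  field_simp
  ring

theorem rpow_neg_le_mul_rpow {x y a e : ℝ} (ha : 0 ≤ a) (hx : 0 < x) (hy : 0 ≤ y)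
    (h : 1 ≤ a * y * x) (he : 0 ≤ e) : x ^ (-e) ≤ a ^ e * y ^ e := by
  rw [← Real.mul_rpow ha hy, Real.rpow_neg hx.le, ← Real.inv_rpow hx.le]
  exact Real.rpow_le_rpow (inv_nonneg.2 hx.le) ((inv_le_iff_one_le_mul₀ hx).2 h) he

theorem mul_rpow_le_rpow_neg {x y a e : ℝ} (ha : 0 < a) (hx : 0 < x) (hy : 0 ≤ y)
    (h : y * x ≤ a) (he : 0 ≤ e) : a ^ (-e) * y ^ e ≤ x ^ (-e) := by
  rw [Real.rpow_neg ha.le, Real.rpow_neg hx.le, ← Real.inv_rpow ha.le, ← Real.inv_rpow hx.le,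
    ← Real.mul_rpow (inv_nonneg.2 ha.le) hy]
  refine Real.rpow_le_rpow (by positivity) ?_ he
  rw [inv_mul_eq_div, inv_eq_one_div, div_le_div_iff₀ ha hx]
  linarith

end GelfandWidth

/-- Two-sided estimate for the Gelfand widths of weak Schatten `p`-balls measured in the
Schatten `q`-quasi-norm, for `0 < p < 1` and `p < q ≤ 2`. -/
theorem gelfand_width_weak_schatten_ball
    (p q : ℝ) (hp0 : 0 < p) (hp1 : p < 1) (hpq : p < q) (hq2 : q ≤ 2) :
    ∃ c C : ℝ, 0 < c ∧ 0 < C ∧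
      ∀ N m : ℕ, 0 < N → 1 ≤ m → m < N ^ 2 →
        c * (min 1 ((N : ℝ) / m)) ^ (1 / p - 1 / q) ≤
            gelfandWidth m {X : Matrix (Fin N) (Fin N) ℝ | weakSchattenNorm p X ≤ 1} q ∧
        gelfandWidth m {X : Matrix (Fin N) (Fin N) ℝ | weakSchattenNorm p X ≤ 1} q ≤
            C * (min 1 ((N : ℝ) / m)) ^ (1 / p - 1 / q) := by
  have hq : 0 < q := hp0.trans hpq
  have hs : 1 < 1 / p := by rwa [lt_div_iff₀ hp0, one_mul]
  have hqs : 1 < q * (1 / p) := by rwa [mul_one_div, one_lt_div hp0]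
  have he : 0 ≤ 1 / p - 1 / q := sub_nonneg.2 (one_div_le_one_div_of_le hp0 hpq.le)
  set e := 1 / p - 1 / q with he_def
  set Z := zetaSum (q * (1 / p)) ^ (1 / q) with hZ
  set D := ((128 / 7 * zetaSum (1 / p)) ^ q + zetaSum (q * (1 / p))) ^ (1 / q) with hD
  have hZpos : 0 < Z := Real.rpow_pos_of_pos (zetaSum_pos hqs) _
  have hDpos : 0 < D := Real.rpow_pos_of_pos (add_pos (Real.rpow_pos_of_pos
    (mul_pos (by norm_num) (zetaSum_pos hs)) q) (zetaSum_pos hqs)) _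
  refine ⟨2 ^ (-e), (Z + D) * 400 ^ e, by positivity, by positivity, fun N m hN hm hmN => ?_⟩
  have hN' : (0 : ℝ) < N := by exact_mod_cast hN
  have hm' : (0 : ℝ) < m := by exact_mod_cast hm
  set μ := min 1 ((N : ℝ) / m) with hμ
  have hμpos : 0 < μ := lt_min one_pos (div_pos hN' hm')
  constructor
  · have hr : m / N + 1 ≤ N := Nat.div_lt_of_lt_mul (by rwa [← sq])
    refine (mul_rpow_le_rpow_neg (x := ((m / N + 1 : ℕ) : ℝ)) two_pos (by positivity) hμpos.le ?_
      he).trans (le_gelfandWidth hp0 hpq hr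
        (by rw [mul_comm]; exact Nat.lt_mul_div_succ m hN))
    have hdiv : ((m / N : ℕ) : ℝ) ≤ m / N := Nat.cast_div_le
    calc μ * ((m / N + 1 : ℕ) : ℝ) ≤ μ * (m / N) + μ := by
          push_cast
          nlinarith
      _ ≤ N / m * (m / N) + 1 := by
          gcongr
          · exact min_le_right _ _
          · exact min_le_left _ _
      _ = 2 := by
          field_simp
          norm_num
  · rcases lt_or_ge m (200 * N) with hlt | hge
    · have hlt' : (m : ℝ) < 200 * N := by exact_mod_cast hlt
      have h1 : (1 : ℝ) ≤ 400 ^ e * μ ^ e := by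
        refine (Real.one_rpow (-e)).ge.trans
          (rpow_neg_le_mul_rpow (by norm_num) one_pos hμpos.le ?_ he)
        have : 1 / 400 ≤ μ := le_min (by norm_num) (by
          rw [div_le_div_iff₀ (by norm_num) hm']
          linarith)
        linarith
      calc _ ≤ Z := gelfandWidth_le_zetaSum hp0 hpq m
        _ ≤ (Z + D) * (400 ^ e * μ ^ e) := by nlinarith
        _ = _ := by ring
    · have hN200 : 0 < 200 * N := by positivity
      set k := m / (200 * N) with hk_def
      have hk : 0 < k := Nat.div_pos hge hN200
      have hkm : 200 * N * k ≤ m := Nat.mul_div_le m _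
      have hmk : m < 200 * N * (k + 1) := Nat.lt_mul_div_succ m hN200
      have hkN : k ≤ N := by
        refine le_of_lt (Nat.div_lt_of_lt_mul (hmN.trans_le ?_))
        nlinarith
      have hmk' : (m : ℝ) ≤ 400 * N * k := by
        have : m ≤ 400 * N * k := by nlinarith
        exact_mod_cast this
      have hk1 : (1 : ℝ) ≤ k := by exact_mod_cast hk
      have hbound : (k : ℝ) ^ (-e) ≤ 400 ^ e * μ ^ e := by
        refine rpow_neg_le_mul_rpow (by norm_num) (by positivity) hμpos.le ?_ he
        have : 1 / (400 * k) ≤ μ := le_min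
          (by rw [div_le_one (by positivity)]; linarith)
          (by rw [div_le_div_iff₀ (by positivity) hm']; linarith)
        rw [div_le_iff₀ (by positivity)] at this
        linarith
      calc _ ≤ D * (k : ℝ) ^ (-e) :=
            gelfandWidth_le_mul_rpow hp0 hp1 hpq hq2 hk hkN (by rwa [← mul_assoc])
        _ ≤ (Z + D) * (400 ^ e * μ ^ e) := by
            gcongr
            linarith
        _ = _ := by ring
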